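/- arXiv:0708.4176 — 4 statements merged into one kernel-verified Lean document; each statement's English description precedes it below -/
import Mathlib

section
/- There exists a set A ⊆ 2^{<ω} of finite binary words which is recursive (membership of a word in A is decidable) and which is a context-free language, such that the ω-power A^∞ belongs to Σ^0_2(2^ω) but not to Π^0_2(2^ω); that is, A^∞ is a countable union of closed sets but is not a Gδ set. -/
open Topology MeasureTheory TopologicalSpace

abbrev Cantor : Type := ℕ → Fin 2

/-- The concatenation of the first `m` words of the sequence `a`. -/
def concatPrefix {β : Type*} (a : ℕ → List β) (m : ℕ) : List β :=
  ((List.range m).map a).flatten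

/-- The ω-power of a set `A` of finite words: the set of all infinite words obtained by
concatenating a sequence of words of `A` (infinitely many of them being nonempty). -/
def omegaPower {β : Type*} (A : Set (List β)) : Set (ℕ → β) :=
  {α | ∃ a : ℕ → List β, (∀ i, a i ∈ A) ∧
    (∀ n, ∃ m, n ≤ (concatPrefix a m).length) ∧
    ∀ (m k : ℕ) (h : k < (concatPrefix a m).length), (concatPrefix a m).get ⟨k, h⟩ = α k}

/-- The Borel class Σ⁰_ξ of a topological space: Σ⁰_ξ is the class of open sets for ξ ≤ 1,
and for ξ ≥ 2 it consists of the countable unions of sets each lying in some Π⁰_η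
with 1 ≤ η < ξ. -/
noncomputable def SigmaZero (X : Type*) [TopologicalSpace X] (ξ : Ordinal.{0}) : Set (Set X) :=
  if ξ ≤ 1 then {s | IsOpen s}
  else {s | ∃ f : ℕ → Set X,
    (∀ n, ∃ η : Ordinal.{0}, ∃ _ : 1 ≤ η, ∃ _ : η < ξ, (f n)ᶜ ∈ SigmaZero X η) ∧
    s = ⋃ n, f n}
termination_by ξ

/-- The Borel class Π⁰_ξ: complements of Σ⁰_ξ sets. -/
noncomputable def PiZero (X : Type*) [TopologicalSpace X] (ξ : Ordinal.{0}) : Set (Set X) :=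
  {s | sᶜ ∈ SigmaZero X ξ}

/-- A topological space is zero-dimensional if it has a basis consisting of clopen sets. -/
def ZeroDim (X : Type*) [TopologicalSpace X] : Prop :=
  ∃ b : Set (Set X), IsTopologicalBasis b ∧ ∀ s ∈ b, IsClopen s

/-! ### Regular languages are recursive and context-free -/

theorem DFA.computablePred_mem_accepts {α σ : Type*} [Primcodable α] [Primcodable σ] [Finite α]
    [Finite σ] (M : DFA α σ) : ComputablePred (· ∈ M.accepts) := by
  classical
  have hstep : Primrec fun p : List α × (σ × α) => M.step p.2.1 p.2.2 :=
    (Primrec.dom_finite fun q : σ × α => M.step q.1 q.2).comp .snd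
  have heval : Primrec fun w : List α => M.eval w :=
    Primrec.list_foldl .id (.const M.start) hstep.to₂
  refine Computable.computablePred (p := (· ∈ M.accepts)) ?_
  exact ((Primrec.dom_finite fun q : σ => decide (q ∈ M.accept)).comp heval).to_comp

open scoped Classical in
/-- The rules of the right-linear grammar of an automaton. -/
noncomputable def DFA.rightLinearRules {α σ : Type*} [Fintype α] [Fintype σ]
    (M : DFA α σ) : Finset (ContextFreeRule α σ) :=
  (Finset.univ.image fun p : σ × α =>
    ⟨p.1, [Symbol.terminal p.2, Symbol.nonterminal (M.step p.1 p.2)]⟩) ∪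
  ((Finset.univ.filter (· ∈ M.accept)).image fun q => ⟨q, []⟩)

/-- The right-linear grammar of an automaton: its nonterminals are the states. -/
noncomputable def DFA.toContextFreeGrammar {α : Type*} {σ : Type} [Fintype α] [Fintype σ]
    (M : DFA α σ) : ContextFreeGrammar α where
  NT := σ
  initial := M.start
  rules := M.rightLinearRules

theorem DFA.mem_rightLinearRules {α σ : Type*} [Fintype α] [Fintype σ]
    (M : DFA α σ) (r : ContextFreeRule α σ) :
    r ∈ M.rightLinearRules ↔
      (∃ q c, r = ⟨q, [Symbol.terminal c, Symbol.nonterminal (M.step q c)]⟩) ∨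
        ∃ q ∈ M.accept, r = ⟨q, []⟩ := by
  simp only [DFA.rightLinearRules, Finset.mem_union, Finset.mem_image, Finset.mem_univ,
    true_and, Prod.exists, Finset.mem_filter, eq_comm (a := r)]

theorem DFA.derives_toContextFreeGrammar {α : Type*} {σ : Type} [Fintype α] [Fintype σ]
    (M : DFA α σ) (q : σ) (w : List α) (h : M.evalFrom q w ∈ M.accept) :
    M.toContextFreeGrammar.Derives [Symbol.nonterminal q] (w.map Symbol.terminal) := by
  induction w generalizing q with
  | nil =>
    refine ContextFreeGrammar.Produces.single ⟨⟨q, []⟩, ?_, ?_⟩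
    · exact (M.mem_rightLinearRules _).2 (.inr ⟨q, h, rfl⟩)
    · exact ContextFreeRule.Rewrites.input_output (r := ⟨q, []⟩)
  | cons c w ih =>
    refine ContextFreeGrammar.Produces.trans_derives
      (v := [Symbol.terminal c, Symbol.nonterminal (M.step q c)])
      ⟨⟨q, [Symbol.terminal c, Symbol.nonterminal (M.step q c)]⟩, ?_, ?_⟩ ?_
    · exact (M.mem_rightLinearRules _).2 (.inl ⟨q, c, rfl⟩)
    · exact ContextFreeRule.Rewrites.input_output
        (r := ⟨q, [Symbol.terminal c, Symbol.nonterminal (M.step q c)]⟩)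
    · exact (ih _ h).append_left [Symbol.terminal c]

theorem ContextFreeRule.Rewrites.of_map_terminal_append {T N : Type*} {r : ContextFreeRule T N}
    (w : List T) {u v : List (Symbol T N)} (h : r.Rewrites (w.map Symbol.terminal ++ u) v) :
    ∃ v', v = w.map Symbol.terminal ++ v' ∧ r.Rewrites u v' := by
  induction w generalizing v with
  | nil => exact ⟨v, rfl, h⟩
  | cons c w ih =>
    cases h with
    | cons _ h =>
      obtain ⟨v', rfl, hv⟩ := ih h
      exact ⟨v', rfl, hv⟩

theorem DFA.shape_of_derives {α : Type*} {σ : Type} [Fintype α] [Fintype σ]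
    (M : DFA α σ) {v : List (Symbol α σ)}
    (h : M.toContextFreeGrammar.Derives [Symbol.nonterminal M.start] v) :
    (∃ w, v = w.map Symbol.terminal ++ [Symbol.nonterminal (M.eval w)]) ∨
      ∃ w ∈ M.accepts, v = w.map Symbol.terminal := by
  induction h with
  | refl => exact .inl ⟨[], rfl⟩
  | tail _ hp ih =>
    obtain ⟨r, hr, hrw⟩ := hp
    rcases ih with ⟨w, rfl⟩ | ⟨w, -, rfl⟩
    · obtain ⟨v', rfl, hv⟩ := hrw.of_map_terminal_append w
      generalize hu : [Symbol.nonterminal (M.eval w)] = u at hv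
      cases hv with
      | cons _ h =>
        cases hu
        cases h
      | head =>
        obtain ⟨hq, rfl⟩ : M.eval w = r.input ∧ [] = _ := by simpa using hu
        rcases (M.mem_rightLinearRules r).1 hr with ⟨q, c, rfl⟩ | ⟨q, hacc, rfl⟩
        · left
          refine ⟨w ++ [c], ?_⟩
          rw [List.map_append, M.eval_append_singleton, hq, List.append_assoc]
          rfl
        · right
          exact ⟨w, (congrArg (· ∈ M.accept) hq).mpr hacc, List.append_nil _⟩
    · have h := (List.append_nil (w.map Symbol.terminal)).symm ▸ hrw
      obtain ⟨v', -, hv⟩ := h.of_map_terminal_append w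
      cases hv

theorem DFA.isContextFree_accepts {α : Type*} {σ : Type} [Finite α] [Finite σ] (M : DFA α σ) :
    M.accepts.IsContextFree := by
  have := Fintype.ofFinite α
  have := Fintype.ofFinite σ
  refine ⟨M.toContextFreeGrammar, ?_⟩
  ext w
  rw [ContextFreeGrammar.mem_language_iff]
  refine ⟨fun h => ?_, M.derives_toContextFreeGrammar M.start w⟩
  have hinj : Function.Injective (List.map (Symbol.terminal : α → Symbol α σ)) :=
    List.map_injective_iff.2 fun _ _ h => by simpa using h
  rcases M.shape_of_derives h with ⟨w', h'⟩ | ⟨w', hw', h'⟩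
  · have hmem : Symbol.nonterminal (M.eval w') ∈ w.map (Symbol.terminal : α → Symbol α σ) :=
      (congrArg (Symbol.nonterminal (M.eval w') ∈ ·) h').mpr (by simp)
    simp at hmem
  · rwa [hinj h']

/-! ### The classes `Σ⁰₂` and `Π⁰₂` -/

theorem mem_sigmaZero_one_iff {X : Type*} [TopologicalSpace X] {s : Set X} :
    s ∈ SigmaZero X 1 ↔ IsOpen s := by
  rw [SigmaZero, if_pos le_rfl, Set.mem_ofPred_eq]

theorem mem_sigmaZero_two_iff {X : Type*} [TopologicalSpace X] {s : Set X} :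
    s ∈ SigmaZero X 2 ↔ IsGδ sᶜ := by
  have h12 : (1 : Ordinal) < 2 := by norm_num
  rw [SigmaZero, if_neg (not_le.2 h12), Set.mem_ofPred_eq, isGδ_iff_eq_iInter_nat]
  constructor
  · rintro ⟨f, hf, rfl⟩
    refine ⟨fun n => (f n)ᶜ, fun n => ?_, Set.compl_iUnion _⟩
    obtain ⟨η, h1, h2, h⟩ := hf n
    have hη : η = 1 := by
      refine le_antisymm (Order.lt_succ_iff.1 ?_) h1
      rwa [Order.succ_eq_add_one, one_add_one_eq_two]
    rw [hη] at h
    exact mem_sigmaZero_one_iff.1 h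
  · rintro ⟨f, hf, hs⟩
    refine ⟨fun n => (f n)ᶜ, fun n => ⟨1, le_rfl, h12, ?_⟩, ?_⟩
    · rw [compl_compl]
      exact mem_sigmaZero_one_iff.2 (hf n)
    · rw [← Set.compl_iInter, ← hs, compl_compl]

theorem mem_piZero_two_iff {X : Type*} [TopologicalSpace X] {s : Set X} :
    s ∈ PiZero X 2 ↔ IsGδ s := by
  rw [PiZero, Set.mem_ofPred_eq, mem_sigmaZero_two_iff, compl_compl]

/-! ### Prefixes, tails and `ω`-powers -/

section Words

variable {β : Type*}

/-- The prefix of length `n` of an infinite word. -/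
def prefixWord (α : ℕ → β) (n : ℕ) : List β := (List.range n).map α

/-- The infinite word obtained by removing the first `n` letters. -/
def tailWord (α : ℕ → β) (n : ℕ) : ℕ → β := fun k => α (n + k)

@[simp]
theorem length_prefixWord (α : ℕ → β) (n : ℕ) : (prefixWord α n).length = n := by
  simp [prefixWord]

theorem prefixWord_succ (α : ℕ → β) (n : ℕ) : prefixWord α (n + 1) = prefixWord α n ++ [α n] := by
  simp [prefixWord, List.range_succ]

theorem prefixWord_append_prefixWord (α : ℕ → β) (m n : ℕ) :
    prefixWord α m ++ prefixWord (tailWord α m) n = prefixWord α (m + n) := by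
  induction n with
  | zero => simp [prefixWord]
  | succ n ih => rw [prefixWord_succ, ← List.append_assoc, ih, ← add_assoc, prefixWord_succ]; rfl

theorem eq_prefixWord_iff {w : List β} {α : ℕ → β} :
    w = prefixWord α w.length ↔ ∀ (k : ℕ) (h : k < w.length), w.get ⟨k, h⟩ = α k := by
  constructor
  · intro hw k h
    simp only [List.get_eq_getElem]
    conv_lhs => rw [List.getElem_of_eq hw]
    simp [prefixWord]
  · intro h
    refine List.ext_getElem (by simp) fun k h₁ h₂ => ?_
    simpa [prefixWord] using h k h₁

theorem mem_omegaPower_iff {A : Set (List β)} {α : ℕ → β} :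
    α ∈ omegaPower A ↔ ∃ a : ℕ → List β, (∀ i, a i ∈ A) ∧
      (∀ n, ∃ m, n ≤ (concatPrefix a m).length) ∧
      ∀ m, concatPrefix a m = prefixWord α (concatPrefix a m).length := by
  simp only [eq_prefixWord_iff]
  rfl

theorem concatPrefix_succ (a : ℕ → List β) (m : ℕ) :
    concatPrefix a (m + 1) = concatPrefix a m ++ a m := by
  simp [concatPrefix, List.range_succ]

theorem concatPrefix_succ_left (a : ℕ → List β) (m : ℕ) :
    concatPrefix a (m + 1) = a 0 ++ concatPrefix (fun i => a (i + 1)) m := by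
  simp [concatPrefix, List.range_succ_eq_map, Function.comp_def]

theorem subset_omegaPower_of_step {A : Set (List β)} {P : Set (ℕ → β)}
    (h : ∀ α ∈ P, ∃ n, 0 < n ∧ prefixWord α n ∈ A ∧ tailWord α n ∈ P) : P ⊆ omegaPower A := by
  intro α hα
  choose! N hpos hmem hnext using h
  let pos : ℕ → ℕ := fun i => Nat.rec 0 (fun _ p => p + N (tailWord α p)) i
  have hsucc : ∀ i, pos (i + 1) = pos i + N (tailWord α (pos i)) := fun _ => rfl
  have hP : ∀ i, tailWord α (pos i) ∈ P := by
    intro i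
    induction i with
    | zero =>
      have h0 : tailWord α (pos 0) = α := funext fun k => congrArg α (Nat.zero_add k)
      rwa [h0]
    | succ i ih =>
      have := hnext _ ih
      rw [hsucc]
      convert this using 1
      funext k
      simp [tailWord, add_assoc]
  let a : ℕ → List β := fun i => prefixWord (tailWord α (pos i)) (N (tailWord α (pos i)))
  have hconcat : ∀ m, concatPrefix a m = prefixWord α (pos m) := by
    intro m
    induction m with
    | zero => rfl
    | succ m ih => rw [concatPrefix_succ, ih, hsucc, ← prefixWord_append_prefixWord]
  have hle : ∀ m, m ≤ pos m := by
    intro m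
    induction m with
    | zero => exact Nat.zero_le _
    | succ m ih =>
      have := hpos _ (hP m)
      rw [hsucc]
      omega
  refine mem_omegaPower_iff.2 ⟨a, fun i => hmem _ (hP i), fun n => ⟨n, ?_⟩, fun m => ?_⟩
  · rw [hconcat, length_prefixWord]
    exact hle n
  · rw [hconcat, length_prefixWord]

theorem exists_step_of_mem_omegaPower {A : Set (List β)} (hA : [] ∉ A) {α : ℕ → β}
    (h : α ∈ omegaPower A) :
    ∃ n, 0 < n ∧ prefixWord α n ∈ A ∧ tailWord α n ∈ omegaPower A := by
  obtain ⟨a, ha, hlen, hpre⟩ := mem_omegaPower_iff.1 h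
  have h0 : a 0 = prefixWord α (a 0).length := by
    simpa [concatPrefix] using hpre 1
  refine ⟨(a 0).length, ?_, h0 ▸ ha 0, ?_⟩
  · exact List.length_pos_iff.2 fun h => hA (h ▸ ha 0)
  · refine mem_omegaPower_iff.2 ⟨fun i => a (i + 1), fun i => ha _, fun n => ?_, fun m => ?_⟩
    · obtain ⟨m, hm⟩ := hlen (n + (a 0).length)
      rcases m with _ | m
      · simp only [concatPrefix, List.range_zero, List.map_nil, List.flatten_nil,
          List.length_nil] at hm
        exact ⟨0, by omega⟩
      · rw [concatPrefix_succ_left, List.length_append] at hm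
        exact ⟨m, by omega⟩
    · have hm := hpre (m + 1)
      rw [concatPrefix_succ_left, List.length_append, ← prefixWord_append_prefixWord, ← h0] at hm
      exact List.append_cancel_left hm

theorem mem_omegaPower_of_tailWord {A : Set (List β)} (hA : [] ∉ A) {α : ℕ → β} {n : ℕ}
    (hn : 0 < n) (hw : prefixWord α n ∈ A) (ht : tailWord α n ∈ omegaPower A) :
    α ∈ omegaPower A := by
  refine subset_omegaPower_of_step (P := insert α (omegaPower A)) ?_ (Set.mem_insert _ _)
  rintro γ (rfl | hγ)
  · exact ⟨n, hn, hw, .inr ht⟩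
  · obtain ⟨k, hk, hw', ht'⟩ := exists_step_of_mem_omegaPower hA hγ
    exact ⟨k, hk, hw', .inr ht'⟩

theorem DFA.eval_prefixWord_succ {σ : Type*} (M : DFA β σ) (α : ℕ → β) (n : ℕ) :
    M.eval (prefixWord α (n + 1)) = M.step (M.eval (prefixWord α n)) (α n) := by
  rw [prefixWord_succ, DFA.eval_append_singleton]

theorem DFA.eval_prefixWord_eq_of_le {σ : Type*} (M : DFA β σ) {q : σ} (hq : ∀ c, M.step q c = q)
    {α : ℕ → β} {m n : ℕ} (hmn : m ≤ n) (h : M.eval (prefixWord α m) = q) :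
    M.eval (prefixWord α n) = q := by
  induction n, hmn using Nat.le_induction with
  | base => exact h
  | succ n _ ih => rw [M.eval_prefixWord_succ, ih, hq]

end Words

/-! ### The automaton -/

/-- An automaton for the language consisting of `111`, the words starting with `0`, the words
`10w` with `w` a product of words `111` and `110`, and the words `10w` with `w` not a prefix of
such a product. -/
def exampleDFA : DFA (Fin 2) (Fin 9) where
  step := ![![7, 1], ![4, 2], ![8, 3], ![8, 8], ![7, 5], ![7, 6], ![4, 4], ![7, 7], ![8, 8]]
  start := 0
  accept := {3, 4, 7}

/-- The language of `exampleDFA`, as a set of words. -/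
def exampleWords : Set (List (Fin 2)) := (exampleDFA.accepts : Set (List (Fin 2)))

/-- The state of `exampleDFA` after reading the first `n` letters of `α`. -/
def exampleRun (α : Cantor) (n : ℕ) : Fin 9 := exampleDFA.eval (prefixWord α n)

@[simp]
theorem exampleRun_zero (α : Cantor) : exampleRun α 0 = 0 := rfl

theorem exampleRun_succ (α : Cantor) (n : ℕ) :
    exampleRun α (n + 1) = exampleDFA.step (exampleRun α n) (α n) :=
  exampleDFA.eval_prefixWord_succ α n

theorem prefixWord_mem_exampleWords {α : Cantor} {n : ℕ} :
    prefixWord α n ∈ exampleWords ↔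
      exampleRun α n = 3 ∨ exampleRun α n = 4 ∨ exampleRun α n = 7 := Iff.rfl

theorem nil_notMem_exampleWords : [] ∉ exampleWords := by
  change ¬ ((0 : Fin 9) ∈ ({3, 4, 7} : Set (Fin 9)))
  simp

theorem exampleRun_eq_seven_of_le {α : Cantor} {m n : ℕ} (hmn : m ≤ n)
    (h : exampleRun α m = 7) : exampleRun α n = 7 :=
  exampleDFA.eval_prefixWord_eq_of_le (by decide) hmn h

theorem exampleRun_eq_eight_of_le {α : Cantor} {m n : ℕ} (hmn : m ≤ n)
    (h : exampleRun α m = 8) : exampleRun α n = 8 :=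
  exampleDFA.eval_prefixWord_eq_of_le (by decide) hmn h

theorem exampleRun_one_of_zero {α : Cantor} (h : α 0 = 0) : exampleRun α 1 = 7 := by
  rw [exampleRun_succ, exampleRun_zero, h]; rfl

theorem exampleRun_two_of_ones {α : Cantor} (h0 : α 0 = 1) (h1 : α 1 = 1) :
    exampleRun α 2 = 2 := by
  rw [exampleRun_succ, exampleRun_succ, exampleRun_zero, h0, h1]; rfl

theorem exampleRun_three_of_ones {α : Cantor} (h0 : α 0 = 1) (h1 : α 1 = 1) (h2 : α 2 = 1) :
    exampleRun α 3 = 3 := by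
  rw [exampleRun_succ, exampleRun_two_of_ones h0 h1, h2]; rfl

theorem mem_omegaPower_of_zero_or_ones {α : Cantor} (h : α 0 = 0 ∨ ∀ n, α n = 1) :
    α ∈ omegaPower exampleWords := by
  refine subset_omegaPower_of_step (P := {α | α 0 = 0 ∨ ∀ n, α n = 1}) ?_ h
  rintro α (h | h)
  · by_cases hz : ∃ n, 0 < n ∧ α n = 0
    · obtain ⟨n, hn, hαn⟩ := hz
      refine ⟨n, hn, prefixWord_mem_exampleWords.2 (.inr (.inr ?_)), .inl hαn⟩
      exact exampleRun_eq_seven_of_le hn (exampleRun_one_of_zero h)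
    · refine ⟨1, one_pos, prefixWord_mem_exampleWords.2 (.inr (.inr ?_)), .inr fun n => ?_⟩
      · exact exampleRun_one_of_zero h
      · have : ¬ α (1 + n) = 0 := fun h' => hz ⟨1 + n, by omega, h'⟩
        change α (1 + n) = 1
        omega
  · refine ⟨3, by norm_num, prefixWord_mem_exampleWords.2 (.inl ?_), .inr fun n => h _⟩
    exact exampleRun_three_of_ones (h 0) (h 1) (h 2)

theorem mem_omegaPower_of_exampleRun_eq_seven {α : Cantor} {m : ℕ} (h : exampleRun α m = 7) :
    α ∈ omegaPower exampleWords := by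
  have hm : 0 < m := by
    rcases Nat.eq_zero_or_pos m with rfl | hm
    · simp at h
    · exact hm
  by_cases hz : ∃ n, m ≤ n ∧ α n = 0
  · obtain ⟨n, hn, hαn⟩ := hz
    refine mem_omegaPower_of_tailWord nil_notMem_exampleWords (hm.trans_le hn)
      (prefixWord_mem_exampleWords.2 (.inr (.inr (exampleRun_eq_seven_of_le hn h))))
      (mem_omegaPower_of_zero_or_ones (.inl hαn))
  · refine mem_omegaPower_of_tailWord nil_notMem_exampleWords hm
      (prefixWord_mem_exampleWords.2 (.inr (.inr h)))
      (mem_omegaPower_of_zero_or_ones (.inr fun n => ?_))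
    have : ¬ α (m + n) = 0 := fun h' => hz ⟨m + n, by omega, h'⟩
    change α (m + n) = 1
    omega

/-- The infinite words that are products of the words `111` and `110`. -/
def blockWords : Set Cantor := {α | ∀ i, α (3 * i) = 1 ∧ α (3 * i + 1) = 1}

theorem tailWord_mem_blockWords {α : Cantor} (h : α ∈ blockWords) (i : ℕ) :
    tailWord α (3 * i) ∈ blockWords := by
  intro j
  have := h (i + j)
  rw [mul_add, add_assoc] at this
  exact this

/-- The first factor of a factorization of an infinite word starting with `11` is `111`. -/
theorem of_prefixWord_mem_of_ones {α : Cantor} (h0 : α 0 = 1) (h1 : α 1 = 1) {n : ℕ} (hn : 0 < n)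
    (h : prefixWord α n ∈ exampleWords) : n = 3 ∧ α 2 = 1 := by
  rw [prefixWord_mem_exampleWords] at h
  have hr1 : exampleRun α 1 = 1 := by rw [exampleRun_succ, exampleRun_zero, h0]; rfl
  have hr2 := exampleRun_two_of_ones h0 h1
  have hr3 : exampleRun α 3 = exampleDFA.step 2 (α 2) := by rw [exampleRun_succ, hr2]
  have h4 : exampleRun α 4 = 8 := by
    rw [exampleRun_succ, hr3]
    generalize α 2 = c
    generalize α 3 = d
    revert c d
    decide
  have hlt : n < 4 := by
    by_contra! hle
    rw [exampleRun_eq_eight_of_le hle h4] at h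
    revert h
    decide
  interval_cases n
  · exfalso
    rw [hr1] at h
    revert h
    decide
  · exfalso
    rw [hr2] at h
    revert h
    decide
  · rw [hr3] at h
    refine ⟨rfl, ?_⟩
    generalize α 2 = c at h
    revert h
    revert c
    decide

theorem eq_one_of_mem_blockWords {α : Cantor} (hb : α ∈ blockWords)
    (h : α ∈ omegaPower exampleWords) (n : ℕ) : α n = 1 := by
  induction n using Nat.strong_induction_on generalizing α with
  | _ n ih =>
    obtain ⟨k, hk, hw, ht⟩ := exists_step_of_mem_omegaPower nil_notMem_exampleWords h
    obtain ⟨rfl, h2⟩ := of_prefixWord_mem_of_ones (hb 0).1 (hb 0).2 hk hw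
    match n with
    | 0 => exact (hb 0).1
    | 1 => exact (hb 0).2
    | 2 => exact h2
    | n + 3 =>
      have := ih n (by omega) (tailWord_mem_blockWords hb 1) ht
      rwa [tailWord, add_comm] at this

theorem exampleRun_two_of_one_zero {α : Cantor} (h0 : α 0 = 1) (h1 : α 1 = 0) :
    exampleRun α 2 = 4 := by
  rw [exampleRun_succ, exampleRun_succ, exampleRun_zero, h0, h1]; rfl

theorem exampleRun_of_blocks {α : Cantor} (h0 : α 0 = 1) (h1 : α 1 = 0)
    (hb : tailWord α 2 ∈ blockWords) (i : ℕ) :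
    exampleRun α (2 + 3 * i) = 4 ∧ exampleRun α (2 + 3 * i + 1) = 5 ∧
      exampleRun α (2 + 3 * i + 2) = 6 := by
  have hstep : ∀ i, exampleRun α (2 + 3 * i) = 4 →
      exampleRun α (2 + 3 * i + 1) = 5 ∧ exampleRun α (2 + 3 * i + 2) = 6 := by
    intro i h4
    have h5 : exampleRun α (2 + 3 * i + 1) = 5 := by
      rw [exampleRun_succ, h4, show α (2 + 3 * i) = 1 from (hb i).1]; rfl
    refine ⟨h5, ?_⟩
    rw [exampleRun_succ, h5, show α (2 + 3 * i + 1) = 1 from (hb i).2]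
    rfl
  refine ⟨?_, hstep i ?_⟩ <;>
  · induction i with
    | zero => exact exampleRun_two_of_one_zero h0 h1
    | succ i ih =>
      rw [show 2 + 3 * (i + 1) = 2 + 3 * i + 2 + 1 by ring, exampleRun_succ, (hstep i ih).2]
      generalize α _ = c
      revert c
      decide

theorem exists_ones_of_blocks {α : Cantor} (h0 : α 0 = 1) (h1 : α 1 = 0)
    (hb : tailWord α 2 ∈ blockWords) (h : α ∈ omegaPower exampleWords) :
    ∃ N, ∀ n, N ≤ n → α n = 1 := by
  obtain ⟨k, hk, hw, ht⟩ := exists_step_of_mem_omegaPower nil_notMem_exampleWords h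
  have hki : ∃ i, k = 2 + 3 * i := by
    rw [prefixWord_mem_exampleWords] at hw
    by_contra! hne
    rcases Nat.lt_or_ge k 2 with hlt | hge
    · obtain rfl : k = 1 := by omega
      rw [exampleRun_succ, exampleRun_zero, h0] at hw
      revert hw
      decide
    · have hr := exampleRun_of_blocks h0 h1 hb ((k - 2) / 3)
      have := hne ((k - 2) / 3)
      have hcases : k = 2 + 3 * ((k - 2) / 3) + 1 ∨ k = 2 + 3 * ((k - 2) / 3) + 2 := by omega
      rcases hcases with hc | hc
      · rw [← hc] at hr
        rw [hr.2.1] at hw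
        revert hw
        decide
      · rw [← hc] at hr
        rw [hr.2.2] at hw
        revert hw
        decide
  obtain ⟨i, rfl⟩ := hki
  refine ⟨2 + 3 * i, fun n hn => ?_⟩
  have hb' : tailWord α (2 + 3 * i) ∈ blockWords := by
    intro j
    have := tailWord_mem_blockWords hb i j
    simpa only [tailWord, add_assoc] using this
  have := eq_one_of_mem_blockWords hb' ht (n - (2 + 3 * i))
  rwa [tailWord, Nat.add_sub_cancel' hn] at this

theorem exists_exampleRun_eq_seven {α : Cantor} (h0 : α 0 = 1) (h1 : α 1 = 0)
    (hb : tailWord α 2 ∉ blockWords) : ∃ m, exampleRun α m = 7 := by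
  by_contra! hne
  have key : ∀ i, exampleRun α (2 + 3 * i) = 4 →
      α (2 + 3 * i) = 1 ∧ α (2 + 3 * i + 1) = 1 ∧ exampleRun α (2 + 3 * (i + 1)) = 4 := by
    intro i h4
    have ha : α (2 + 3 * i) = 1 := by
      have := hne (2 + 3 * i + 1)
      rw [exampleRun_succ, h4] at this
      generalize α (2 + 3 * i) = c at this
      revert this
      revert c
      decide
    have h5 : exampleRun α (2 + 3 * i + 1) = 5 := by rw [exampleRun_succ, h4, ha]; rfl
    have hb : α (2 + 3 * i + 1) = 1 := by
      have := hne (2 + 3 * i + 1 + 1)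
      rw [exampleRun_succ, h5] at this
      generalize α (2 + 3 * i + 1) = c at this
      revert this
      revert c
      decide
    have h6 : exampleRun α (2 + 3 * i + 1 + 1) = 6 := by rw [exampleRun_succ, h5, hb]; rfl
    refine ⟨ha, hb, ?_⟩
    rw [show 2 + 3 * (i + 1) = 2 + 3 * i + 1 + 1 + 1 by ring, exampleRun_succ, h6]
    generalize α _ = c
    revert c
    decide
  have h4 : ∀ i, exampleRun α (2 + 3 * i) = 4 := by
    intro i
    induction i with
    | zero => exact exampleRun_two_of_one_zero h0 h1
    | succ i ih => exact (key i ih).2.2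
  exact hb fun i => ⟨(key i (h4 i)).1, (key i (h4 i)).2.1⟩

/-! ### Topology -/

theorem isOpen_setOf_exampleRun_eq (m : ℕ) (q : Fin 9) : IsOpen {α | exampleRun α m = q} := by
  have hcont : Continuous fun α : Cantor => exampleRun α m := by
    induction m with
    | zero => exact continuous_const
    | succ m ih =>
      have h : (fun α : Cantor => exampleRun α (m + 1)) =
          (fun p : Fin 9 × Fin 2 => exampleDFA.step p.1 p.2) ∘
            fun α : Cantor => (exampleRun α m, α m) :=
        funext fun α => exampleRun_succ α m
      rw [h]
      exact continuous_of_discreteTopology.comp (ih.prodMk (continuous_apply m))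
  exact (isOpen_discrete {q}).preimage hcont

theorem continuous_tailWord (n : ℕ) : Continuous fun α : Cantor => tailWord α n :=
  continuous_pi fun k => continuous_apply (n + k)

theorem mem_interior_of_mem_omegaPower {α : Cantor} (h : α ∈ omegaPower exampleWords)
    (hα : ¬ ∃ N, ∀ n, N ≤ n → α n = 1) : α ∈ interior (omegaPower exampleWords) := by
  have hseven : ∀ {α : Cantor} {m : ℕ}, exampleRun α m = 7 →
      α ∈ interior (omegaPower exampleWords) := fun {α m} hm =>
    mem_interior.2 ⟨_, fun _ => mem_omegaPower_of_exampleRun_eq_seven,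
      isOpen_setOf_exampleRun_eq m 7, hm⟩
  have hz : ∃ m, α m = 0 := by
    by_contra! hne
    exact hα ⟨0, fun n _ => by have := hne n; omega⟩
  obtain ⟨m, hm⟩ := hz
  induction m using Nat.strong_induction_on generalizing α with
  | _ m ih =>
    by_cases h0 : α 0 = 0
    · exact hseven (exampleRun_one_of_zero h0)
    replace h0 : α 0 = 1 := by omega
    by_cases h1 : α 1 = 0
    · by_cases hb : tailWord α 2 ∈ blockWords
      · exact (hα (exists_ones_of_blocks h0 h1 hb h)).elim
      · obtain ⟨k, hk⟩ := exists_exampleRun_eq_seven h0 h1 hb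
        exact hseven hk
    replace h1 : α 1 = 1 := by omega
    obtain ⟨k, hk, hw, ht⟩ := exists_step_of_mem_omegaPower nil_notMem_exampleWords h
    obtain ⟨rfl, h2⟩ := of_prefixWord_mem_of_ones h0 h1 hk hw
    have hm3 : 3 ≤ m := by
      by_contra! hlt
      interval_cases m <;> simp_all
    have htail : tailWord α 3 ∈ interior (omegaPower exampleWords) := by
      refine ih (m - 3) (by omega) ht ?_ ?_
      · rintro ⟨N, hN⟩
        refine hα ⟨N + 3, fun n hn => ?_⟩
        have := hN (n - 3) (by omega)
        rwa [tailWord, Nat.add_sub_cancel' (by omega)] at this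
      · rwa [tailWord, Nat.add_sub_cancel' hm3]
    refine mem_interior.2 ⟨{γ | exampleRun γ 3 = 3} ∩
      (fun γ => tailWord γ 3) ⁻¹' interior (omegaPower exampleWords), ?_, ?_, ?_, htail⟩
    · rintro γ ⟨hγ, hγt⟩
      exact mem_omegaPower_of_tailWord nil_notMem_exampleWords (by norm_num)
        (prefixWord_mem_exampleWords.2 (.inl hγ)) (interior_subset hγt)
    · exact (isOpen_setOf_exampleRun_eq 3 3).inter (isOpen_interior.preimage (continuous_tailWord 3))
    · exact exampleRun_three_of_ones h0 h1 h2

/-- The infinite words that are eventually equal to `c`. -/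
def eventuallyConst (c : Fin 2) : Set Cantor := {α | ∃ N, ∀ n, N ≤ n → α n = c}

theorem countable_eventuallyConst (c : Fin 2) : (eventuallyConst c).Countable := by
  refine (Set.countable_range fun w : List (Fin 2) => fun n => w.getD n c).mono ?_
  rintro α ⟨N, hN⟩
  refine ⟨prefixWord α N, funext fun n => ?_⟩
  rcases Nat.lt_or_ge n N with hn | hn
  · simp [prefixWord, List.getD, hn]
  · simp [prefixWord, List.getD, hn, hN n hn]

theorem dense_eventuallyConst (c : Fin 2) : Dense (eventuallyConst c) := by
  intro α
  refine mem_closure_of_tendsto (f := fun N k => if k < N then α k else c) (b := Filter.atTop) ?_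
    (Filter.Eventually.of_forall fun N => ⟨N, fun n hn => if_neg (not_lt.2 hn)⟩)
  refine tendsto_pi_nhds.2 fun k => tendsto_const_nhds.congr' ?_
  filter_upwards [Filter.eventually_gt_atTop k] with N hN
  exact (if_pos hN).symm

theorem not_isGδ_eventuallyConst : ¬ IsGδ (eventuallyConst 1) := by
  intro h
  have hdense : Dense (eventuallyConst 1)ᶜ := by
    refine (dense_eventuallyConst 0).mono ?_
    rintro α ⟨N, hN⟩ ⟨N', hN'⟩
    have h0 := hN (max N N') (le_max_left _ _)
    rw [hN' (max N N') (le_max_right _ _)] at h0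
    exact absurd h0 (by decide)
  obtain ⟨α, h1, h2⟩ := ((dense_eventuallyConst 1).inter_of_Gδ h
    (countable_eventuallyConst 1).isGδ_compl hdense).nonempty
  exact h2 h1

theorem isGδ_compl_omegaPower : IsGδ (omegaPower exampleWords)ᶜ := by
  have h : (omegaPower exampleWords : Set Cantor)ᶜ =
      (interior (omegaPower exampleWords))ᶜ ∩ (omegaPower exampleWords ∩ eventuallyConst 1)ᶜ := by
    rw [← Set.compl_union]
    congr 1
    refine Set.Subset.antisymm (fun α hα => ?_)
      (Set.union_subset interior_subset Set.inter_subset_left)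
    by_cases hc : α ∈ eventuallyConst 1
    · exact .inr ⟨hα, hc⟩
    · exact .inl (mem_interior_of_mem_omegaPower hα hc)
  rw [h]
  let := TopologicalSpace.metrizableSpaceMetric Cantor
  exact isOpen_interior.isClosed_compl.isGδ.inter
    ((countable_eventuallyConst 1).mono Set.inter_subset_right).isGδ_compl

/-- The infinite word `10` followed by the blocks `11βᵢ`. -/
def blockEncode (β : Cantor) : Cantor
  | 0 => 1
  | 1 => 0
  | n + 2 => if n % 3 = 2 then β (n / 3) else 1

theorem continuous_blockEncode : Continuous blockEncode := by
  refine continuous_pi fun n => ?_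
  match n with
  | 0 => exact continuous_const
  | 1 => exact continuous_const
  | n + 2 =>
    by_cases h : n % 3 = 2
    · simpa only [blockEncode, if_pos h] using continuous_apply (n / 3)
    · simpa only [blockEncode, if_neg h] using continuous_const

theorem tailWord_blockEncode_mem (β : Cantor) : tailWord (blockEncode β) 2 ∈ blockWords := by
  intro i
  constructor
  · rw [tailWord, add_comm, blockEncode, if_neg (by omega)]
  · rw [tailWord, add_comm, blockEncode, if_neg (by omega)]

theorem blockEncode_mem_omegaPower_iff (β : Cantor) :
    blockEncode β ∈ omegaPower exampleWords ↔ β ∈ eventuallyConst 1 := by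
  have hb := tailWord_blockEncode_mem β
  have hval : ∀ i, blockEncode β (3 * i + 2 + 2) = β i := by
    intro i
    rw [blockEncode, if_pos (by omega)]
    congr 1
    omega
  constructor
  · intro h
    obtain ⟨N, hN⟩ := exists_ones_of_blocks rfl rfl hb h
    exact ⟨N, fun n hn => by rw [← hval]; exact hN _ (by omega)⟩
  · rintro ⟨N, hN⟩
    refine mem_omegaPower_of_tailWord nil_notMem_exampleWords (n := 2 + 3 * N) (by omega)
      (prefixWord_mem_exampleWords.2 (.inr (.inl (exampleRun_of_blocks rfl rfl hb N).1)))
      (mem_omegaPower_of_zero_or_ones (.inr fun n => ?_))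
    rw [tailWord, show 2 + 3 * N + n = 3 * N + n + 2 by ring, blockEncode]
    split_ifs
    · exact hN _ (by omega)
    · rfl

theorem not_isGδ_omegaPower : ¬ IsGδ (omegaPower exampleWords : Set Cantor) := by
  intro h
  have hpre : blockEncode ⁻¹' omegaPower exampleWords = eventuallyConst 1 :=
    Set.ext blockEncode_mem_omegaPower_iff
  exact not_isGδ_eventuallyConst (hpre ▸ h.preimage continuous_blockEncode)

/-- There is a recursive (and even context-free) language A ⊆ 2^{<ω} such that
A^∞ ∈ Σ⁰₂(2^ω) \ Π⁰₂(2^ω). -/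
theorem recursive_cf_sigma2_not_pi2_omega_power :
    ∃ A : Language (Fin 2),
      ComputablePred (· ∈ A) ∧
      A.IsContextFree ∧
      omegaPower (A : Set (List (Fin 2))) ∈ SigmaZero Cantor 2 ∧
      omegaPower (A : Set (List (Fin 2))) ∉ PiZero Cantor 2 := by
  exact ⟨exampleDFA.accepts, exampleDFA.computablePred_mem_accepts,
    exampleDFA.isContextFree_accepts, mem_sigmaZero_two_iff.2 isGδ_compl_omegaPower,
    fun h => not_isGδ_omegaPower (mem_piZero_two_iff.1 h)⟩
end

section
/- Let ξ ≥ 1 be a countable ordinal, X a zero-dimensional Polish space, and B ∈ Π^0_{ξ+1}(X). Then there exist a closed set C ⊆ ω^ω and a continuous bijection f : C → B whose inverse is Σ^0_ξ-measurable, i.e. f[U] ∈ Σ^0_ξ(B) (the class Σ^0_ξ computed in the subspace B of X) for every open subset U of C. -/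
open Topology MeasureTheory TopologicalSpace

namespace SigmaZero

variable {X Y : Type*} [TopologicalSpace X] [TopologicalSpace Y] {ξ η : Ordinal.{0}}

theorem mem_iff_of_le_one (h : ξ ≤ 1) {s : Set X} : s ∈ SigmaZero X ξ ↔ IsOpen s := by
  rw [SigmaZero, if_pos h]; rfl

theorem mem_iff_of_one_lt (h : 1 < ξ) {s : Set X} : s ∈ SigmaZero X ξ ↔
    ∃ f : ℕ → Set X, (∀ n, ∃ η : Ordinal.{0}, 1 ≤ η ∧ η < ξ ∧ (f n)ᶜ ∈ SigmaZero X η) ∧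
      s = ⋃ n, f n := by
  rw [SigmaZero, if_neg (not_le.2 h)]
  simp only [exists_prop]
  rfl

theorem mem_of_compl_mem (h1 : 1 ≤ η) (h : η < ξ) {s : Set X} (hs : sᶜ ∈ SigmaZero X η) :
    s ∈ SigmaZero X ξ :=
  (mem_iff_of_one_lt (h1.trans_lt h)).2
    ⟨fun _ => s, fun _ => ⟨η, h1, h, hs⟩, (Set.iUnion_const s).symm⟩

theorem mem_of_isOpen [MetrizableSpace X] {s : Set X} (hs : IsOpen s) : s ∈ SigmaZero X ξ := by
  rcases le_or_gt ξ 1 with h | h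
  · exact (mem_iff_of_le_one h).2 hs
  · let := metrizableSpaceMetric X
    obtain ⟨F, hF, -, hU, -⟩ := hs.exists_iUnion_isClosed
    exact (mem_iff_of_one_lt h).2 ⟨F, fun n => ⟨1, le_rfl, h,
      (mem_iff_of_le_one le_rfl).2 (hF n).isOpen_compl⟩, hU.symm⟩

theorem mono [MetrizableSpace X] (h : η ≤ ξ) {s : Set X} (hs : s ∈ SigmaZero X η) :
    s ∈ SigmaZero X ξ := by
  rcases le_or_gt η 1 with h1 | h1
  · exact mem_of_isOpen ((mem_iff_of_le_one h1).1 hs)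
  · obtain ⟨f, hf, rfl⟩ := (mem_iff_of_one_lt h1).1 hs
    refine (mem_iff_of_one_lt (h1.trans_le h)).2 ⟨f, fun n => ?_, rfl⟩
    obtain ⟨ζ, hζ, hlt, hc⟩ := hf n
    exact ⟨ζ, hζ, hlt.trans_le h, hc⟩

theorem iUnion_nat {s : ℕ → Set X} (hs : ∀ n, s n ∈ SigmaZero X ξ) :
    ⋃ n, s n ∈ SigmaZero X ξ := by
  rcases le_or_gt ξ 1 with h | h
  · exact (mem_iff_of_le_one h).2 (isOpen_iUnion fun n => (mem_iff_of_le_one h).1 (hs n))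
  · choose f hf hsf using fun n => (mem_iff_of_one_lt h).1 (hs n)
    refine (mem_iff_of_one_lt h).2
      ⟨fun m => f m.unpair.1 m.unpair.2, fun m => hf _ _, ?_⟩
    rw [Set.iUnion_unpair f]
    exact Set.iUnion_congr hsf

theorem iUnion [MetrizableSpace X] {ι : Type*} [Countable ι] {s : ι → Set X}
    (hs : ∀ i, s i ∈ SigmaZero X ξ) : ⋃ i, s i ∈ SigmaZero X ξ := by
  rcases isEmpty_or_nonempty ι with h | h
  · rw [Set.iUnion_of_empty]
    exact mem_of_isOpen isOpen_empty
  · obtain ⟨f, hf⟩ := exists_surjective_nat ι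
    rw [← hf.iUnion_comp]
    exact iUnion_nat fun n => hs (f n)

theorem union [MetrizableSpace X] {s t : Set X} (hs : s ∈ SigmaZero X ξ)
    (ht : t ∈ SigmaZero X ξ) : s ∪ t ∈ SigmaZero X ξ := by
  rw [Set.union_eq_iUnion]
  exact iUnion fun b => by cases b <;> assumption

theorem inter [MetrizableSpace X] {s t : Set X} (hs : s ∈ SigmaZero X ξ)
    (ht : t ∈ SigmaZero X ξ) : s ∩ t ∈ SigmaZero X ξ := by
  rcases le_or_gt ξ 1 with h | h
  · exact (mem_iff_of_le_one h).2
      (((mem_iff_of_le_one h).1 hs).inter ((mem_iff_of_le_one h).1 ht))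
  · obtain ⟨f, hf, rfl⟩ := (mem_iff_of_one_lt h).1 hs
    obtain ⟨g, hg, rfl⟩ := (mem_iff_of_one_lt h).1 ht
    rw [Set.iUnion_inter_iUnion]
    refine iUnion fun i => iUnion fun j => ?_
    obtain ⟨η₁, h1, hlt₁, hc₁⟩ := hf i
    obtain ⟨η₂, -, hlt₂, hc₂⟩ := hg j
    refine mem_of_compl_mem (h1.trans (le_max_left η₁ η₂)) (max_lt hlt₁ hlt₂) ?_
    rw [Set.compl_inter]
    exact union (mono (le_max_left _ _) hc₁) (mono (le_max_right _ _) hc₂)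

theorem biInter_finset [MetrizableSpace X] {ι : Type*} {s : ι → Set X} (t : Finset ι)
    (hs : ∀ i ∈ t, s i ∈ SigmaZero X ξ) : ⋂ i ∈ t, s i ∈ SigmaZero X ξ := by
  classical
  induction t using Finset.induction_on with
  | empty => simpa using mem_of_isOpen isOpen_univ
  | insert a t _ ih =>
    rw [Finset.set_biInter_insert]
    exact inter (hs a (Finset.mem_insert_self a t))
      (ih fun i hi => hs i (Finset.mem_insert_of_mem hi))

theorem preimage {f : X → Y} (hf : Continuous f) {s : Set Y} (hs : s ∈ SigmaZero Y ξ) :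
    f ⁻¹' s ∈ SigmaZero X ξ := by
  induction ξ using WellFoundedLT.induction generalizing s with
  | ind ξ ih =>
    rcases le_or_gt ξ 1 with h | h
    · exact (mem_iff_of_le_one h).2 (((mem_iff_of_le_one h).1 hs).preimage hf)
    · obtain ⟨F, hF, rfl⟩ := (mem_iff_of_one_lt h).1 hs
      refine (mem_iff_of_one_lt h).2 ⟨fun n => f ⁻¹' F n, fun n => ?_, Set.preimage_iUnion⟩
      obtain ⟨η, h1, hlt, hc⟩ := hF n
      exact ⟨η, h1, hlt, ih η hlt hc⟩

/-- A map to the Baire space whose coordinates have `Σ⁰_ξ` fibres is `Σ⁰_ξ`-measurable. -/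
theorem preimage_baire [MetrizableSpace X] {g : X → ℕ → ℕ}
    (hg : ∀ n j, {x | g x n = j} ∈ SigmaZero X ξ) {U : Set (ℕ → ℕ)} (hU : IsOpen U) :
    g ⁻¹' U ∈ SigmaZero X ξ := by
  have hU' : g ⁻¹' U = ⋃ p : {p : List ℕ // ∀ y : ℕ → ℕ,
      (∀ i ∈ Finset.range p.length, y i = p.getD i 0) → y ∈ U},
      ⋂ i ∈ Finset.range p.1.length, {x | g x i = p.1.getD i 0} := by
    ext x
    simp only [Set.mem_preimage, Set.mem_iUnion, Set.mem_iInter, Set.mem_ofPred_eq]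
    constructor
    · intro hx
      obtain ⟨n, hn⟩ : ∃ n, PiNat.cylinder (g x) n ⊆ U := by
        obtain ⟨_, ⟨z, n, rfl⟩, hz, hzU⟩ :=
          (PiNat.isTopologicalBasis_cylinders fun _ : ℕ => ℕ).exists_subset_of_mem_open hx hU
        exact ⟨n, (PiNat.mem_cylinder_iff_eq.1 hz).trans_subset hzU⟩
      refine ⟨⟨List.ofFn fun i : Fin n => g x i, fun y hy => hn fun i hi => ?_⟩, fun i hi => ?_⟩
      · have := hy i (by simpa using hi)
        simpa [List.getD, hi] using this
      · have : i < n := by simpa using hi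
        simp [List.getD, this]
    · rintro ⟨p, hp⟩
      exact p.2 _ hp
  rw [hU']
  exact iUnion fun p => biInter_finset _ fun i _ => hg _ _

end SigmaZero

/-- Enumerate a sequence of maps to the Baire space as a single map. -/
def interleave {X : Type*} (h : ℕ → X → ℕ → ℕ) (x : X) (m : ℕ) : ℕ :=
  h m.unpair.1 x m.unpair.2

theorem interleave_pair {X : Type*} (h : ℕ → X → ℕ → ℕ) (x : X) (n k : ℕ) :
    interleave h x (Nat.pair n k) = h n x k := by
  simp [interleave]

theorem exists_firstIndex {X : Type*} (A : ℕ → Set X) : ∃ k : X → ℕ,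
    (∀ x, k x = 0 ↔ ∀ j, x ∉ A j) ∧
    ∀ x m, k x = m + 1 ↔ x ∈ A m ∧ ∀ j < m, x ∉ A j := by
  classical
  refine ⟨fun x => if h : ∃ n, x ∈ A n then Nat.find h + 1 else 0, fun x => ?_, fun x m => ?_⟩
  · by_cases h : ∃ n, x ∈ A n
    · simp [h]
    · simp [not_exists.1 h]
  · by_cases h : ∃ n, x ∈ A n
    · simp [h, Nat.find_eq_iff]
    · have h' := not_exists.1 h
      simp [h, h' m]

section Coding

variable {X : Type*} [TopologicalSpace X]

/-- Sequential closedness of the graph of a map to the Baire space. -/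
def SeqClosedGraph (h : X → ℕ → ℕ) : Prop :=
  ∀ (u : ℕ → X) (x : X) (y : ℕ → ℕ), Filter.Tendsto u Filter.atTop (𝓝 x) →
    (∀ n, ∀ᶠ i in Filter.atTop, h (u i) n = y n) → h x = y

/-- `A` is decided by the first coordinate of a map to the Baire space with closed graph,
all of whose coordinates have `Σ⁰_ξ` fibres. -/
def IsDecided (ξ : Ordinal.{0}) (A : Set X) : Prop :=
  ∃ h : X → ℕ → ℕ, SeqClosedGraph h ∧ (∀ n j, {x | h x n = j} ∈ SigmaZero X ξ) ∧
    ∃ J : Set ℕ, A = {x | h x 0 ∈ J}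

variable {ξ η : Ordinal.{0}}

theorem IsDecided.compl {A : Set X} (hA : IsDecided ξ A) : IsDecided ξ Aᶜ := by
  obtain ⟨h, hc, hm, J, rfl⟩ := hA
  exact ⟨h, hc, hm, Jᶜ, rfl⟩

theorem IsDecided.mem_sigmaZero [MetrizableSpace X] {A : Set X} (hA : IsDecided ξ A) :
    A ∈ SigmaZero X ξ := by
  obtain ⟨h, -, hm, J, rfl⟩ := hA
  have : {x | h x 0 ∈ J} = ⋃ j : J, {x | h x 0 = j} := by ext; simp
  rw [this]
  exact SigmaZero.iUnion fun j => hm 0 j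

theorem IsClopen.isDecided [MetrizableSpace X] {A : Set X} (hA : IsClopen A) :
    IsDecided ξ A := by
  classical
  have hopen : ∀ j, IsOpen {x | (if x ∈ A then 0 else 1) = j} := by
    intro j
    have : {x | (if x ∈ A then 0 else 1) = j} =
        (A ∩ {_x | 0 = j}) ∪ (Aᶜ ∩ {_x | 1 = j}) := by
      ext x
      by_cases hx : x ∈ A <;> simp [hx]
    rw [this]
    exact (hA.isOpen.inter isOpen_const).union (hA.compl.isOpen.inter isOpen_const)
  refine ⟨fun x _ => if x ∈ A then 0 else 1, fun u x y hu hy => ?_,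
    fun n j => SigmaZero.mem_of_isOpen (hopen j), {0}, ?_⟩
  · funext n
    have h1 := hu.eventually ((hopen (if x ∈ A then 0 else 1)).mem_nhds rfl)
    obtain ⟨i, h1, h2⟩ := (h1.and (hy n)).exists
    exact h1.symm.trans h2
  · ext x
    by_cases hx : x ∈ A <;> simp [hx]

/-- A countable union of decided sets is semi-decided: the only fibre that need not be `Σ⁰_ξ`
is the one over `0` of the first coordinate, which is the complement of the union. -/
theorem exists_seqClosedGraph_iUnion [MetrizableSpace X] {A : ℕ → Set X}
    (hA : ∀ n, IsDecided ξ (A n)) : ∃ h : X → ℕ → ℕ, SeqClosedGraph h ∧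
      (∀ n j, ¬ (n = 0 ∧ j = 0) → {x | h x n = j} ∈ SigmaZero X ξ) ∧
      {x | h x 0 = 0} = (⋃ n, A n)ᶜ := by
  have hA' := hA
  choose h hc hm J hJ using hA'
  obtain ⟨k, hk0, hk⟩ := exists_firstIndex A
  have hkm : ∀ m, {x | k x = m + 1} ∈ SigmaZero X ξ := by
    intro m
    have : {x | k x = m + 1} = A m ∩ ⋂ j ∈ Finset.range m, (A j)ᶜ := by
      ext x; simp [hk]
    rw [this]
    exact SigmaZero.inter (hA m).mem_sigmaZero
      (SigmaZero.biInter_finset _ fun j _ => (hA j).compl.mem_sigmaZero)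
  refine ⟨fun x n => Nat.casesOn n (k x) (interleave h x), fun u x y hu hy => ?_,
    fun n j hnj => ?_, ?_⟩
  · have hx : ∀ n, h n x = fun i => y (Nat.pair n i + 1) := by
      intro n
      refine hc n u x _ hu fun i => ?_
      simpa only [interleave_pair] using hy (Nat.pair n i + 1)
    have hev : ∀ n, ∀ᶠ i in Filter.atTop, (u i ∈ A n ↔ x ∈ A n) := by
      intro n
      filter_upwards [hy (Nat.pair n 0 + 1)] with i hi
      simp only [interleave_pair] at hi
      rw [hJ n]
      simp only [Set.mem_ofPred_eq, hi, hx n]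
    funext n
    cases n with
    | zero =>
      change k x = y 0
      have h0 : ∀ᶠ i in Filter.atTop, k (u i) = y 0 := hy 0
      rcases hy0 : y 0 with _ | m
      · rw [hk0]
        intro j hj
        obtain ⟨i, hi, hi'⟩ := (h0.and (hev j)).exists
        rw [hy0, hk0] at hi
        exact hi j (hi'.2 hj)
      · rw [hk]
        refine ⟨?_, fun j hjm hj => ?_⟩
        · obtain ⟨i, hi, hi'⟩ := (h0.and (hev m)).exists
          rw [hy0, hk] at hi
          exact hi'.1 hi.1
        · obtain ⟨i, hi, hi'⟩ := (h0.and (hev j)).exists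
          rw [hy0, hk] at hi
          exact hi.2 j hjm (hi'.2 hj)
    | succ n =>
      change h _ x _ = _
      rw [hx]
      simp
  · cases n with
    | zero =>
      cases j with
      | zero => exact absurd ⟨rfl, rfl⟩ hnj
      | succ m => exact hkm m
    | succ n => exact hm _ _ _
  · ext x
    simp [hk0]

theorem IsDecided.of_iUnion [MetrizableSpace X] {A : ℕ → Set X} (h1 : 1 ≤ η) (h : η < ξ)
    (hA : ∀ n, IsDecided η (A n)) : IsDecided ξ (⋃ n, A n) := by
  obtain ⟨g, hc, hm, h0⟩ := exists_seqClosedGraph_iUnion hA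
  refine ⟨g, hc, fun n j => ?_, {0}ᶜ, ?_⟩
  · by_cases hnj : n = 0 ∧ j = 0
    · obtain ⟨rfl, rfl⟩ := hnj
      refine SigmaZero.mem_of_compl_mem h1 h ?_
      rw [h0, compl_compl]
      exact SigmaZero.iUnion fun n => (hA n).mem_sigmaZero
    · exact SigmaZero.mono h.le (hm n j hnj)
  · rw [← compl_compl (⋃ n, A n), ← h0]
    rfl

theorem exists_nat_clopen_cover [SecondCountableTopology X] {S : Set (Set X)}
    (hS : ∀ s ∈ S, IsClopen s) : ∃ V : ℕ → Set X,
      (∀ k, IsClopen (V k) ∧ (V k ∈ S ∨ V k = ∅)) ∧ ⋃ k, V k = ⋃₀ S := by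
  obtain ⟨T, hT, hTS, hTU⟩ := isOpen_sUnion_countable S fun s hs => (hS s hs).isOpen
  obtain ⟨V, hV⟩ := (hT.insert ∅).exists_eq_range (Set.insert_nonempty _ _)
  have hmem : ∀ k, V k ∈ S ∨ V k = ∅ := by
    intro k
    have : V k ∈ insert ∅ T := hV ▸ Set.mem_range_self k
    rcases this with h | h
    · exact Or.inr h
    · exact Or.inl (hTS h)
  refine ⟨V, fun k => ⟨?_, hmem k⟩, ?_⟩
  · rcases hmem k with h | h
    · exact hS _ h
    · exact h ▸ isClopen_empty
  · rw [← Set.sUnion_range, ← hV, Set.sUnion_insert, Set.empty_union, hTU]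

theorem exists_iUnion_isDecided [MetrizableSpace X] [SecondCountableTopology X] (hX : ZeroDim X)
    {A : Set X} (hA : A ∈ SigmaZero X ξ) :
    ∃ F : ℕ → Set X, (∀ n, IsDecided ξ (F n)) ∧ A = ⋃ n, F n := by
  induction ξ using WellFoundedLT.induction generalizing A with
  | ind ξ ih =>
    rcases le_or_gt ξ 1 with h | h
    · obtain ⟨b, hb, hclopen⟩ := hX
      obtain ⟨S, hSb, rfl⟩ := hb.open_eq_sUnion ((SigmaZero.mem_iff_of_le_one h).1 hA)
      obtain ⟨V, hV, hVS⟩ := exists_nat_clopen_cover fun s hs => hclopen s (hSb hs)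
      exact ⟨V, fun n => (hV n).1.isDecided, hVS.symm⟩
    · obtain ⟨F, hF, rfl⟩ := (SigmaZero.mem_iff_of_one_lt h).1 hA
      refine ⟨F, fun n => ?_, rfl⟩
      obtain ⟨η, h1, hlt, hc⟩ := hF n
      obtain ⟨G, hG, hGF⟩ := ih η hlt hc
      rw [← compl_compl (F n), hGF]
      exact (IsDecided.of_iUnion h1 hlt hG).compl

end Coding

/-- A zero-dimensional Polish space embeds as a closed subspace of the Baire space. -/
theorem ZeroDim.exists_proper_baire {X : Type*} [TopologicalSpace X] [PolishSpace X]
    (hX : ZeroDim X) : ∃ e : X → ℕ → ℕ, (∀ n j, IsOpen {x | e x n = j}) ∧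
      ∀ (u : ℕ → X) (y : ℕ → ℕ), (∀ n, ∀ᶠ i in Filter.atTop, e (u i) n = y n) →
        ∃ x, Filter.Tendsto u Filter.atTop (𝓝 x) := by
  let := upgradeIsCompletelyMetrizable X
  obtain ⟨b, hb, hclopen⟩ := hX
  have hV : ∀ n : ℕ, ∃ V : ℕ → Set X, (∀ k, IsClopen (V k) ∧
      ∀ x ∈ V k, ∀ y ∈ V k, dist x y < 1 / ((n : ℝ) + 1)) ∧ ⋃ k, V k = Set.univ := by
    intro n
    obtain ⟨V, hV, hVS⟩ := exists_nat_clopen_cover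
      (S := {s ∈ b | ∀ x ∈ s, ∀ y ∈ s, dist x y < 1 / ((n : ℝ) + 1)}) fun s hs => hclopen s hs.1
    refine ⟨V, fun k => ⟨(hV k).1, ?_⟩, ?_⟩
    · rcases (hV k).2 with h | h
      · exact h.2
      · simp [h]
    · rw [hVS, Set.eq_univ_iff_forall]
      intro x
      have hpos : (0 : ℝ) < 1 / ((n : ℝ) + 1) / 2 := by positivity
      obtain ⟨s, hs, hxs, hsub⟩ :=
        hb.exists_subset_of_mem_open (Metric.mem_ball_self (x := x) hpos) Metric.isOpen_ball
      refine ⟨s, ⟨hs, fun y hy z hz => ?_⟩, hxs⟩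
      have h1 := Metric.mem_ball.1 (hsub hy)
      have h2 := Metric.mem_ball.1 (hsub hz)
      have h3 := dist_triangle_right y z x
      linarith
  choose V hV hcover using hV
  choose k hk0 hk using fun n => exists_firstIndex (V n)
  have hne : ∀ n x, k n x ≠ 0 := by
    intro n x h
    obtain ⟨j, hj⟩ := Set.mem_iUnion.1 ((hcover n).symm ▸ Set.mem_univ x : x ∈ ⋃ j, V n j)
    exact (hk0 n x).1 h j hj
  refine ⟨fun x n => k n x, fun n j => ?_, fun u y hy => ?_⟩
  · cases j with
    | zero => simp [hne]
    | succ m =>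
      have : {x | k n x = m + 1} = V n m ∩ ⋂ j ∈ Finset.range m, (V n j)ᶜ := by
        ext x; simp [hk]
      rw [this]
      exact (hV n m).1.isOpen.inter
        (isOpen_biInter_finset fun j _ => (hV n j).1.compl.isOpen)
  · refine cauchySeq_tendsto_of_complete (Metric.cauchySeq_iff'.2 fun ε hε => ?_)
    obtain ⟨n, hn⟩ := exists_nat_one_div_lt hε
    obtain ⟨N, hN⟩ := Filter.eventually_atTop.1 (hy n)
    have hmem : ∀ i ≥ N, u i ∈ V n (y n - 1) := by
      intro i hi
      have h1 : k n (u i) = y n := hN i hi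
      have h2 := hne n (u i)
      exact ((hk n (u i) (y n - 1)).1 (by omega)).1
    exact ⟨N, fun i hi => ((hV n _).2 _ (hmem i hi) _ (hmem N le_rfl)).trans hn⟩

/-- A map `g` to the Baire space with closed range and continuous inverse, in sequential terms. -/
theorem exists_isClosed_bijection_of_seq {B : Type*} [TopologicalSpace B] [T2Space B]
    {g : B → ℕ → ℕ}
    (hg : ∀ (u : ℕ → B) (y : ℕ → ℕ), Filter.Tendsto (g ∘ u) Filter.atTop (𝓝 y) →
      ∃ x, Filter.Tendsto u Filter.atTop (𝓝 x) ∧ g x = y) (hinj : Function.Injective g) :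
    ∃ C : Set (ℕ → ℕ), IsClosed C ∧ ∃ f : C → B, Continuous f ∧ Function.Bijective f ∧
      ∀ c, g (f c) = c := by
  let E := Equiv.ofInjective g hinj
  have hE : ∀ c, g (E.symm c) = c := fun c => Equiv.apply_ofInjective_symm hinj c
  refine ⟨Set.range g, IsSeqClosed.isClosed fun z y hz hy => ?_, E.symm, ?_, E.symm.bijective, hE⟩
  · choose u hu using hz
    obtain ⟨x, -, hx⟩ := hg u y (by rwa [show g ∘ u = z from funext hu])
    exact ⟨x, hx⟩
  · refine continuous_iff_seqContinuous.2 fun c c₀ hc => ?_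
    have hc' : Filter.Tendsto (g ∘ fun i => E.symm (c i)) Filter.atTop (𝓝 c₀.1) := by
      simpa only [Function.comp_def, hE] using (continuous_subtype_val.tendsto c₀).comp hc
    obtain ⟨x, hx, hgx⟩ := hg _ _ hc'
    rwa [hinj (hgx.trans (hE c₀).symm)] at hx

/-- Kuratowski's theorem: for every countable ordinal ξ ≥ 1, every zero-dimensional Polish
space X and every B ∈ Π⁰_{ξ+1}(X), there is a closed set C ⊆ ω^ω and a continuous bijection
f : C → B whose inverse is Σ⁰_ξ-measurable (the image of every open subset of C belongs to
Σ⁰_ξ of the subspace B). -/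
theorem kuratowski_closed_continuous_bijection (ξ : Ordinal.{0}) (hξ : 1 ≤ ξ)
    (hcount : ξ.card ≤ Cardinal.aleph0)
    (X : Type) [TopologicalSpace X] [PolishSpace X] (hX : ZeroDim X)
    (B : Set X) (hB : B ∈ PiZero X (ξ + 1)) :
    ∃ C : Set (ℕ → ℕ), IsClosed C ∧
      ∃ f : C → B, Continuous f ∧ Function.Bijective f ∧
        ∀ U : Set C, IsOpen U → f '' U ∈ SigmaZero B ξ := by
  have hlt : 1 < ξ + 1 := hξ.trans_lt (lt_add_one ξ)
  obtain ⟨F, hF, hBF⟩ := (SigmaZero.mem_iff_of_one_lt hlt).1 hB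
  have hF' : ∀ n, ∃ h : X → ℕ → ℕ, SeqClosedGraph h ∧
      (∀ m j, ¬ (m = 0 ∧ j = 0) → {x | h x m = j} ∈ SigmaZero X ξ) ∧
      {x | h x 0 = 0} = F n := by
    intro n
    obtain ⟨η, -, hη, hc⟩ := hF n
    obtain ⟨A, hA, hAF⟩ :=
      exists_iUnion_isDecided hX (SigmaZero.mono (Order.lt_add_one_iff.1 hη) hc)
    obtain ⟨h, h1, h2, h3⟩ := exists_seqClosedGraph_iUnion hA
    exact ⟨h, h1, h2, by rw [h3, ← hAF, compl_compl]⟩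
  choose h hc hm h0 using hF'
  have hmemB : ∀ x, x ∈ B ↔ ∀ n, h n x 0 ≠ 0 := by
    intro x
    rw [← Set.notMem_compl_iff, hBF, Set.mem_iUnion, not_exists]
    refine forall_congr' fun n => ?_
    rw [← h0 n]
    rfl
  obtain ⟨e, heo, he⟩ := hX.exists_proper_baire
  let H : ℕ → X → ℕ → ℕ := fun n => Nat.casesOn n e h
  let g : B → ℕ → ℕ := fun x => interleave H x
  have hge : ∀ x m, g x (Nat.pair 0 m) = e x m := fun x m => interleave_pair H x 0 m
  have hgh : ∀ x n m, g x (Nat.pair (n + 1) m) = h n x m :=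
    fun x n m => interleave_pair H x (n + 1) m
  have hlim : ∀ (u : ℕ → B) (y : ℕ → ℕ), Filter.Tendsto (g ∘ u) Filter.atTop (𝓝 y) →
      ∃ x, Filter.Tendsto u Filter.atTop (𝓝 x) ∧ g x = y := by
    intro u y hy
    have hy' : ∀ m, ∀ᶠ i in Filter.atTop, g (u i) m = y m := fun m => by
      simpa [nhds_discrete] using tendsto_pi_nhds.1 hy m
    obtain ⟨x, hx⟩ := he (fun i => u i) (fun m => y (Nat.pair 0 m)) fun m => by
      simpa only [hge] using hy' (Nat.pair 0 m)
    have hhx : ∀ n, h n x = fun m => y (Nat.pair (n + 1) m) := fun n =>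
      hc n (fun i => u i) x _ hx fun m => by
        simpa only [hgh] using hy' (Nat.pair (n + 1) m)
    have hxB : x ∈ B := by
      refine (hmemB x).2 fun n => ?_
      obtain ⟨i, hi⟩ := (hy' (Nat.pair (n + 1) 0)).exists
      rw [hhx n]
      change y (Nat.pair (n + 1) 0) ≠ 0
      rw [← hi, hgh]
      exact (hmemB _).1 (u i).2 n
    refine ⟨⟨x, hxB⟩, tendsto_subtype_rng.2 hx, ?_⟩
    funext m
    rw [← Nat.pair_unpair m]
    generalize m.unpair.2 = k
    rcases m.unpair.1 with _ | n
    · obtain ⟨i, hi, hi'⟩ := ((hx.eventually ((heo k (e x k)).mem_nhds rfl)).and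
        (hy' (Nat.pair 0 k))).exists
      rw [hge] at hi' ⊢
      exact hi.symm.trans hi'
    · rw [hgh]
      exact congrFun (hhx n) k
  have hinj : Function.Injective g := by
    intro a b hab
    obtain ⟨x, hx⟩ := he (fun i => if Even i then (a : X) else b) (e a) fun m => by
      refine Filter.Eventually.of_forall fun i => ?_
      split_ifs
      · rfl
      · rw [← hge, ← hge, hab]
    have ha : x = a := by
      refine tendsto_nhds_unique (hx.comp (Filter.tendsto_atTop_mono
        (fun n : ℕ => (by omega : n ≤ 2 * n)) Filter.tendsto_id)) ?_
      simp [Function.comp_def]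
    have hb : x = b := by
      refine tendsto_nhds_unique (hx.comp (Filter.tendsto_atTop_mono
        (fun n : ℕ => (by omega : n ≤ 2 * n + 1)) Filter.tendsto_id)) ?_
      simp [Function.comp_def]
    exact Subtype.ext (ha.symm.trans hb)
  have hgm : ∀ n j, {x | g x n = j} ∈ SigmaZero B ξ := by
    intro m j
    rw [← Nat.pair_unpair m]
    generalize m.unpair.2 = k
    rcases m.unpair.1 with _ | n
    · simp only [hge]
      exact SigmaZero.mem_of_isOpen ((heo k j).preimage continuous_subtype_val)
    · simp only [hgh]
      by_cases hkj : k = 0 ∧ j = 0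
      · obtain ⟨rfl, rfl⟩ := hkj
        have : {x : B | h n x 0 = 0} = ∅ :=
          Set.eq_empty_of_forall_notMem fun x hx => (hmemB x).1 x.2 n hx
        rw [this]
        exact SigmaZero.mem_of_isOpen isOpen_empty
      · exact SigmaZero.preimage continuous_subtype_val (hm n k j hkj)
  obtain ⟨C, hC, f, hf, hbij, hgf⟩ := exists_isClosed_bijection_of_seq hlim hinj
  refine ⟨C, hC, f, hf, hbij, fun U hU => ?_⟩
  obtain ⟨W, hW, rfl⟩ := isOpen_induced_iff.1 hU
  have : f '' (Subtype.val ⁻¹' W) = g ⁻¹' W := by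
    ext x
    constructor
    · rintro ⟨c, hc, rfl⟩
      simpa [hgf] using hc
    · intro hx
      obtain ⟨c, rfl⟩ := hbij.2 x
      exact ⟨c, by simpa [hgf] using hx, rfl⟩
  rw [this]
  exact SigmaZero.preimage_baire hgm hW
end

section
/- For each countable ordinal ξ with 1 ≤ ξ < ω₁, there exists a Borel set B ⊆ 2^ω × 2^ω such that the set {α ∈ 2^ω : B_α ∈ Σ^0_ξ(2^ω)} is Π^1_1-complete; similarly, there exists a Borel set B ⊆ 2^ω × 2^ω such that {α ∈ 2^ω : B_α ∈ Π^0_ξ(2^ω)} is Π^1_1-complete. (Here B_α := {β ∈ 2^ω : (α,β) ∈ B}.) -/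
open Topology MeasureTheory TopologicalSpace

/-- A set is coanalytic (Π¹₁) if its complement is analytic. -/
def Coanalytic {X : Type*} [TopologicalSpace X] (P : Set X) : Prop :=
  MeasureTheory.AnalyticSet Pᶜ

/-- A set is Σ¹₂ if it is the projection of a coanalytic subset of `X × ω^ω`. -/
def Sigma12 {X : Type*} [TopologicalSpace X] (P : Set X) : Prop :=
  ∃ Q : Set (X × (ℕ → ℕ)), Coanalytic Q ∧ P = Prod.fst '' Q

/-- A set is Π¹₂ if its complement is Σ¹₂. -/
def Pi12 {X : Type*} [TopologicalSpace X] (P : Set X) : Prop :=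
  Sigma12 Pᶜ

/-- A set `C` is Π¹₁-complete if it is coanalytic and every coanalytic subset of every
zero-dimensional Polish space is a continuous preimage of `C`. -/
def Pi11Complete {Y : Type*} [TopologicalSpace Y] (C : Set Y) : Prop :=
  Coanalytic C ∧
  ∀ (X : Type) [TopologicalSpace X] [PolishSpace X], ZeroDim X →
    ∀ P : Set X, Coanalytic P → ∃ f : X → Y, Continuous f ∧ P = f ⁻¹' C

/-! ### Basic closure properties of the classes -/

theorem mem_sigmaZero_of_isClopen {X : Type*} [TopologicalSpace X] {s : Set X} (hs : IsClopen s)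
    (ξ : Ordinal.{0}) : s ∈ SigmaZero X ξ := by
  rw [SigmaZero]
  split_ifs with h
  · exact hs.isOpen
  · refine ⟨fun _ => s, fun _ => ⟨1, le_rfl, not_le.mp h, ?_⟩, (Set.iUnion_const s).symm⟩
    rw [SigmaZero, if_pos le_rfl]
    exact hs.compl.isOpen

theorem preimage_mem_sigmaZero {X Y : Type*} [TopologicalSpace X] [TopologicalSpace Y]
    {f : X → Y} (hf : Continuous f) (ξ : Ordinal.{0}) {s : Set Y} (hs : s ∈ SigmaZero Y ξ) :
    f ⁻¹' s ∈ SigmaZero X ξ := by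
  induction ξ using WellFoundedLT.induction generalizing s with
  | ind ξ ih =>
    rw [SigmaZero] at hs ⊢
    split_ifs at hs ⊢ with h
    · exact hs.preimage hf
    · obtain ⟨g, hg, rfl⟩ := hs
      refine ⟨fun n => f ⁻¹' g n, fun n => ?_, Set.preimage_iUnion⟩
      obtain ⟨η, h1, hη, hc⟩ := hg n
      exact ⟨η, h1, hη, ih η hη hc⟩

/-! ### The Borel hierarchy does not collapse -/

instance : PolishSpace Cantor := {}

instance uncountable_nat_arrow (α : Type*) [Nontrivial α] : Uncountable (ℕ → α) := by
  obtain ⟨a, b, hab⟩ := exists_pair_ne α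
  have h : Uncountable (Set ℕ) := by
    rw [← Cardinal.aleph0_lt_mk_iff, Cardinal.mk_set, Cardinal.mk_nat]
    exact Cardinal.cantor _
  classical
  refine Function.Injective.uncountable (f := fun (s : Set ℕ) n => if n ∈ s then a else b) ?_
  intro s t hst
  ext n
  have := congrFun hst n
  by_cases hs : n ∈ s <;> by_cases ht : n ∈ t <;> simp_all [hab.symm]

theorem exists_measurable_surjective_cantor (P : Type*) [MeasurableSpace P]
    [StandardBorelSpace P] [Uncountable P] :
    ∃ f : Cantor → P, Measurable f ∧ Function.Surjective f :=
  let e : Cantor ≃ᵐ P := PolishSpace.measurableEquivOfNotCountable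
    (not_countable_iff.mpr inferInstance) (not_countable_iff.mpr inferInstance)
  ⟨e, e.measurable, e.surjective⟩

theorem exists_seq_isOpen_generating (X : Type*) [TopologicalSpace X]
    [SecondCountableTopology X] :
    ∃ b : ℕ → Set X, (∀ n, IsOpen (b n)) ∧
      ∀ s, IsOpen s → ∃ p : Cantor, s = {x | ∃ n, p n = 1 ∧ x ∈ b n} := by
  classical
  obtain ⟨b, hb⟩ := exists_seq_basis X
  refine ⟨b, fun n => hb.isOpen ⟨n, rfl⟩,
    fun s hs => ⟨fun n => if b n ⊆ s then 1 else 0, Set.ext fun x => ?_⟩⟩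
  simp only [Set.mem_ofPred_eq]
  constructor
  · intro hx
    obtain ⟨_, ⟨n, rfl⟩, hxn, hn⟩ := hb.exists_subset_of_mem_open hx hs
    exact ⟨n, by simp [hn], hxn⟩
  · rintro ⟨n, hn, hx⟩
    by_cases h : b n ⊆ s
    · exact h hx
    · simp [h] at hn

/-- Every class `Σ⁰_ξ` with `ξ` countable is parametrized by the sections of a Borel set. -/
theorem exists_measurableSet_universal_sigmaZero (ξ : Ordinal.{0})
    (hξ : ξ.card ≤ Cardinal.aleph0) :
    ∃ U : Set (Cantor × Cantor), MeasurableSet U ∧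
      ∀ s ∈ SigmaZero Cantor ξ, ∃ p, s = {x | (p, x) ∈ U} := by
  induction ξ using WellFoundedLT.induction with
  | ind ξ ih =>
    by_cases h : ξ ≤ 1
    · obtain ⟨b, hb, hs⟩ := exists_seq_isOpen_generating Cantor
      refine ⟨⋃ n, {q | q.1 n = 1 ∧ q.2 ∈ b n}, .iUnion fun n => .inter ?_ ?_, fun s hsξ => ?_⟩
      · exact measurableSet_eq_fun (by fun_prop) measurable_const
      · exact (hb n).measurableSet.preimage measurable_snd
      · rw [SigmaZero, if_pos h] at hsξ
        simpa using hs s hsξ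
    · have hc : Countable (Set.Iio ξ) := by
        rw [← Cardinal.mk_le_aleph0_iff, Cardinal.mk_Iio_ordinal]
        rwa [Cardinal.lift_le_aleph0]
      have : Nonempty (Set.Iio ξ) := ⟨⟨1, not_le.mp h⟩⟩
      obtain ⟨e, he⟩ := exists_surjective_nat (Set.Iio ξ)
      choose U hUm hU using fun n => ih (e n) (e n).2 ((Ordinal.card_le_card (e n).2.le).trans hξ)
      obtain ⟨f, hf, hfs⟩ := exists_measurable_surjective_cantor (ℕ → ℕ × Cantor)
      have hm : MeasurableSet {q : (ℕ × Cantor) × Cantor | (q.1.2, q.2) ∉ U q.1.1} := by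
        have : {q : (ℕ × Cantor) × Cantor | (q.1.2, q.2) ∉ U q.1.1} =
            ⋃ k, {q | q.1.1 = k} ∩ {q | (q.1.2, q.2) ∈ U k}ᶜ := by
          ext q; simp
        rw [this]
        refine .iUnion fun k => .inter ?_ (MeasurableSet.compl ?_)
        · exact measurableSet_eq_fun (by fun_prop) measurable_const
        · exact (hUm k).preimage (by fun_prop)
      refine ⟨⋃ n, (fun q => (f q.1 n, q.2)) ⁻¹' {q | (q.1.2, q.2) ∉ U q.1.1},
        .iUnion fun n => hm.preimage ?_, fun s hs => ?_⟩
      · exact ((measurable_pi_apply n).comp (hf.comp measurable_fst)).prodMk measurable_snd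
      · rw [SigmaZero, if_neg h] at hs
        obtain ⟨g, hg, rfl⟩ := hs
        have key : ∀ n, ∃ c : ℕ × Cantor, g n = {x | (c.2, x) ∉ U c.1} := by
          intro n
          obtain ⟨η, -, hη, hgη⟩ := hg n
          obtain ⟨k, hk⟩ := he ⟨η, hη⟩
          obtain ⟨p, hp⟩ := hU k (g n)ᶜ (by rwa [hk])
          exact ⟨(k, p), by rw [← compl_compl (g n), hp]; rfl⟩
        choose c hgc using key
        obtain ⟨p, hp⟩ := hfs c
        refine ⟨p, ?_⟩
        ext x
        simp [hp, hgc]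

theorem exists_measurableSet_notMem_sigmaZero (ξ : Ordinal.{0})
    (hξ : ξ.card ≤ Cardinal.aleph0) :
    ∃ D : Set Cantor, MeasurableSet D ∧ D ∉ SigmaZero Cantor ξ := by
  obtain ⟨U, hUm, hU⟩ := exists_measurableSet_universal_sigmaZero ξ hξ
  refine ⟨{x | (x, x) ∈ U}ᶜ, (hUm.preimage (by fun_prop)).compl, fun hD => ?_⟩
  obtain ⟨p, hp⟩ := hU _ hD
  have : p ∈ {x | (x, x) ∈ U}ᶜ ↔ p ∈ {x | (p, x) ∈ U} := by rw [hp]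
  simp at this

/-! ### Universal analytic sets -/

theorem exists_continuous_injective_cantor {X : Type*} [TopologicalSpace X] [T2Space X]
    [SecondCountableTopology X] (hX : ZeroDim X) :
    ∃ f : X → Cantor, Continuous f ∧ Function.Injective f := by
  classical
  obtain ⟨b, hb, hclopen⟩ := hX
  obtain ⟨T, hT, hTeq⟩ := isOpen_iUnion_countable (fun U : b => (U : Set X) ×ˢ (U : Set X)ᶜ)
    fun U => (hclopen U U.2).isOpen.prod (hclopen U U.2).compl.isOpen
  obtain ⟨g, hg⟩ := ((hT.image Subtype.val).insert ∅).exists_eq_range (Set.insert_nonempty _ _)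
  have hgc : ∀ n, IsClopen (g n) := by
    intro n
    have hn : g n ∈ insert ∅ (Subtype.val '' T) := hg ▸ Set.mem_range_self n
    rcases hn with hn | ⟨U, -, hn⟩
    · rw [hn]; exact isClopen_empty
    · rw [← hn]; exact hclopen U U.2
  refine ⟨fun x n => if x ∈ g n then 1 else 0, continuous_pi fun n => ?_, fun x y hxy => ?_⟩
  · exact (IsLocallyConstant.const 1).continuous.if
      (fun x hx => absurd hx ((hgc n).frontier_eq ▸ Set.notMem_empty x))
      continuous_const
  · by_contra hne
    obtain ⟨U, hU, hxU, hUy⟩ :=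
      hb.exists_subset_of_mem_open (show x ∈ ({y}ᶜ : Set X) from hne) isOpen_compl_singleton
    have hmem : (x, y) ∈ ⋃ U : b, (U : Set X) ×ˢ (U : Set X)ᶜ :=
      Set.mem_iUnion.mpr ⟨⟨U, hU⟩, hxU, fun h => hUy h rfl⟩
    rw [← hTeq] at hmem
    obtain ⟨V, hV, hxV, hyV⟩ := Set.mem_iUnion₂.mp hmem
    have hVg : (V : Set X) ∈ Set.range g := hg ▸ Or.inr ⟨V, hV, rfl⟩
    obtain ⟨n, hn⟩ := hVg
    have := congrFun hxy n
    simp only [hn] at this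
    rw [if_pos hxV, if_neg hyV] at this
    exact one_ne_zero this

/-- There is a Borel set whose projection is a universal analytic set. -/
theorem exists_measurableSet_universal_analytic :
    ∃ V : Set ((Cantor × Cantor) × Cantor), MeasurableSet V ∧
      ∀ Q : Set Cantor, AnalyticSet Q → ∃ p, Q = {x | ∃ z, ((p, x), z) ∈ V} := by
  obtain ⟨b, hb, hgen⟩ := exists_seq_isOpen_generating (Cantor × (ℕ → ℕ))
  obtain ⟨e, he, hes⟩ := exists_measurable_surjective_cantor (ℕ → ℕ)
  refine ⟨(⋃ n, {q | q.1.1 n = 1 ∧ (q.1.2, e q.2) ∈ b n})ᶜ,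
    (MeasurableSet.iUnion fun n => .inter ?_ ?_).compl, fun Q hQ => ?_⟩
  · exact measurableSet_eq_fun (by fun_prop) measurable_const
  · exact (hb n).measurableSet.preimage (by fun_prop)
  · obtain ⟨F, hF, hFQ⟩ : ∃ F : Set (Cantor × (ℕ → ℕ)), IsClosed F ∧ Q = Prod.fst '' F := by
      rw [AnalyticSet] at hQ
      rcases hQ with rfl | ⟨f, hf, rfl⟩
      · exact ⟨∅, isClosed_empty, by simp⟩
      · refine ⟨{q | f q.2 = q.1}, isClosed_eq (by fun_prop) (by fun_prop), ?_⟩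
        ext x; simp
    obtain ⟨p, hp⟩ := hgen Fᶜ hF.isOpen_compl
    refine ⟨p, Set.ext fun x => ?_⟩
    have hmem : ∀ y, (x, y) ∈ F ↔ ¬ ∃ n, p n = 1 ∧ (x, y) ∈ b n := fun y => by
      rw [← Set.notMem_compl_iff, hp]; rfl
    simp only [hFQ, Set.mem_image, Prod.exists, exists_and_right, exists_eq_right,
      Set.mem_ofPred_eq, Set.mem_compl_iff, Set.mem_iUnion, hmem]
    exact hes.exists

theorem nonempty_homeomorph_cantor_prod : Nonempty (Cantor ≃ₜ Cantor × Cantor) :=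
  ⟨(Homeomorph.piCongrLeft (Y := fun _ => Fin 2) Equiv.natSumNatEquivNat).symm.trans
    Homeomorph.sumArrowHomeomorphProdArrow⟩

/-- A Borel subset of the plane whose projection is `Σ¹₁`-complete. -/
theorem exists_measurableSet_pi11Complete_compl_image_fst :
    ∃ G : Set (Cantor × Cantor), MeasurableSet G ∧ Pi11Complete (Prod.fst '' G)ᶜ := by
  obtain ⟨V, hV, hVu⟩ := exists_measurableSet_universal_analytic
  obtain ⟨h⟩ := nonempty_homeomorph_cantor_prod
  have hG : MeasurableSet {q : Cantor × Cantor | (h q.1, q.2) ∈ V} :=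
    hV.preimage ((h.continuous.measurable.comp measurable_fst).prodMk measurable_snd)
  refine ⟨_, hG, ?_, fun X _ _ hX P hP => ?_⟩
  · rw [Coanalytic, compl_compl]
    exact hG.analyticSet.image_of_continuous continuous_fst
  · obtain ⟨f, hf, hfi⟩ := exists_continuous_injective_cantor hX
    obtain ⟨p, hp⟩ := hVu (f '' Pᶜ) (AnalyticSet.image_of_continuous hP hf)
    refine ⟨fun x => h.symm (p, f x), by fun_prop, Set.ext fun x => ?_⟩
    have hx : x ∈ Pᶜ ↔ ∃ z, ((p, f x), z) ∈ V := by
      rw [← hfi.mem_set_image, hp]; rfl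
    rw [← not_iff_not, ← Set.mem_compl_iff, hx]
    simp

/-! ### Borel sets whose sections in a given class form a complete set -/

/-- If a family of sets is closed under continuous preimages, contains the empty set and misses
some Borel set, then the set of sections in it can be made `Π¹₁`-complete. -/
theorem exists_measurableSet_sections_pi11Complete {Γ : Set (Set Cantor)}
    (hpre : ∀ f : Cantor → Cantor, Continuous f → ∀ s ∈ Γ, f ⁻¹' s ∈ Γ) (hempty : ∅ ∈ Γ)
    {D : Set Cantor} (hD : MeasurableSet D) (hDΓ : D ∉ Γ) :
    ∃ B : Set (Cantor × Cantor), MeasurableSet B ∧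
      Pi11Complete {α : Cantor | {β | (α, β) ∈ B} ∈ Γ} := by
  obtain ⟨G, hG, hGc⟩ := exists_measurableSet_pi11Complete_compl_image_fst
  obtain ⟨h⟩ := nonempty_homeomorph_cantor_prod
  have hm : Measurable h := h.continuous.measurable
  refine ⟨{q | (q.1, (h q.2).1) ∈ G} ∩ {q | (h q.2).2 ∈ D},
    (hG.preimage (by fun_prop)).inter (hD.preimage (by fun_prop)), ?_⟩
  convert hGc using 1
  ext α
  simp only [Set.mem_ofPred_eq, Set.mem_inter_iff, Set.mem_compl_iff, Set.mem_image, Prod.exists,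
    exists_and_right, exists_eq_right, not_exists]
  constructor
  · intro hα β hβ
    refine hDΓ ?_
    convert hpre (fun γ => h.symm (β, γ)) (by fun_prop) _ hα using 1
    ext γ
    simp [hβ]
  · intro hα
    convert hempty
    ext β
    simp [hα]

/-- For each countable ordinal ξ ≥ 1 there is a Borel set B ⊆ 2^ω × 2^ω such that
{α | B_α ∈ Σ⁰_ξ} is Π¹₁-complete, and a Borel set B with {α | B_α ∈ Π⁰_ξ} Π¹₁-complete. -/
theorem sections_in_borel_class_pi11_complete (ξ : Ordinal.{0}) (hξ : 1 ≤ ξ)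
    (hcount : ξ.card ≤ Cardinal.aleph0) :
    (∃ B : Set (Cantor × Cantor), MeasurableSet B ∧
      Pi11Complete {α : Cantor | {β | (α, β) ∈ B} ∈ SigmaZero Cantor ξ}) ∧
    (∃ B : Set (Cantor × Cantor), MeasurableSet B ∧
      Pi11Complete {α : Cantor | {β | (α, β) ∈ B} ∈ PiZero Cantor ξ}) := by
  obtain ⟨D, hD, hDξ⟩ := exists_measurableSet_notMem_sigmaZero ξ hcount
  refine ⟨exists_measurableSet_sections_pi11Complete
      (fun f hf s hs => preimage_mem_sigmaZero hf ξ hs)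
      (mem_sigmaZero_of_isClopen isClopen_empty ξ) hD hDξ,
    exists_measurableSet_sections_pi11Complete
      (fun f hf s hs => preimage_mem_sigmaZero hf ξ hs) ?_ hD.compl ?_⟩
  · exact mem_sigmaZero_of_isClopen isClopen_empty.compl ξ
  · rwa [PiZero, Set.mem_ofPred_eq, compl_compl]
end

section
/- Let P ⊆ 2^ω be a Π^1_2 set. Then there exists a coanalytic set C ⊆ 2^ω × 2^ω such that P = {α ∈ 2^ω : C_α is Borel}, where C_α := {β : (α,β) ∈ C}. -/
open Topology MeasureTheory TopologicalSpace

/-- Every closed subset of a second countable space is coded by a point of the Baire space, and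
the resulting coding relation is closed. -/
lemma exists_universal_isClosed (X : Type*) [TopologicalSpace X] [SecondCountableTopology X] :
    ∃ U : Set ((ℕ → ℕ) × X), IsClosed U ∧
      ∀ F : Set X, IsClosed F → ∃ e : ℕ → ℕ, ∀ x, x ∈ F ↔ (e, x) ∈ U := by
  obtain ⟨b, hbc, -, hb⟩ := exists_countable_basis X
  have hc : (insert ∅ b).Countable := hbc.insert ∅
  obtain ⟨B, hB⟩ := hc.exists_eq_range ⟨∅, Set.mem_insert _ _⟩
  have hBo : ∀ n, IsOpen (B n) := by
    intro n
    have : B n ∈ insert ∅ b := hB ▸ Set.mem_range_self n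
    rcases this with h | h
    · simp [h]
    · exact hb.isOpen h
  refine ⟨{p | ∀ n, p.2 ∉ B (p.1 n)}, ?_, ?_⟩
  · rw [Set.ofPred_forall]
    refine isClosed_iInter fun n => ⟨?_⟩
    have : {p : (ℕ → ℕ) × X | p.2 ∉ B (p.1 n)}ᶜ =
        ⋃ k, {p : (ℕ → ℕ) × X | p.1 n = k} ∩ {p | p.2 ∈ B k} := by
      ext p; simp
    rw [this]
    refine isOpen_iUnion fun k => IsOpen.inter ?_ ((hBo k).preimage continuous_snd)
    have hcont : Continuous fun p : (ℕ → ℕ) × X => p.1 n := by fun_prop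
    exact (isOpen_discrete ({k} : Set ℕ)).preimage hcont
  · intro F hF
    obtain ⟨S, hSb, hS⟩ := hb.open_eq_sUnion hF.isOpen_compl
    have hS' : (insert ∅ S).Countable := (hbc.mono hSb).insert ∅
    obtain ⟨f, hf⟩ := hS'.exists_eq_range ⟨∅, Set.mem_insert _ _⟩
    have hfB : ∀ n, ∃ k, B k = f n := by
      intro n
      have : f n ∈ insert ∅ S := hf ▸ Set.mem_range_self n
      have := Set.insert_subset_insert (a := ∅) hSb this
      rwa [hB] at this
    choose e he using hfB
    refine ⟨e, fun x => ?_⟩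
    have hx : x ∈ Fᶜ ↔ ∃ n, x ∈ f n := by
      have : (∃ n, x ∈ f n) ↔ ∃ t ∈ insert ∅ S, x ∈ t := by rw [hf]; simp
      rw [this, hS]
      simp
    simp only [Set.mem_ofPred_eq, he]
    rw [← not_exists, ← hx, Set.mem_compl_iff, not_not]

/-- An analytic set is the projection of a closed set along the Baire space. -/
lemma MeasureTheory.AnalyticSet.exists_isClosed_fst_image {X : Type*} [TopologicalSpace X]
    [T2Space X] {s : Set X} (hs : AnalyticSet s) :
    ∃ F : Set (X × (ℕ → ℕ)), IsClosed F ∧ ∀ x, x ∈ s ↔ ∃ y, (x, y) ∈ F := by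
  rw [AnalyticSet] at hs
  rcases hs with rfl | ⟨f, hf, rfl⟩
  · exact ⟨∅, isClosed_empty, by simp⟩
  · exact ⟨{p | f p.2 = p.1}, isClosed_eq (hf.comp continuous_snd) continuous_fst, by simp⟩

/-- There is an analytic non-Borel subset of the Baire space. -/
lemma exists_analyticSet_not_measurableSet :
    ∃ A : Set (ℕ → ℕ), AnalyticSet A ∧ ¬ MeasurableSet A := by
  obtain ⟨U, hU, huniv⟩ := exists_universal_isClosed ((ℕ → ℕ) × (ℕ → ℕ))
  have hcl : IsClosed {p : (ℕ → ℕ) × (ℕ → ℕ) | (p.1, p) ∈ U} :=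
    hU.preimage (continuous_fst.prodMk continuous_id)
  refine ⟨Prod.fst '' {p : (ℕ → ℕ) × (ℕ → ℕ) | (p.1, p) ∈ U},
    hcl.analyticSet.image_of_continuous continuous_fst, fun hA => ?_⟩
  obtain ⟨F, hF, hAF⟩ := hA.compl.analyticSet.exists_isClosed_fst_image
  obtain ⟨e, he⟩ := huniv F hF
  have h := hAF e
  simp only [he] at h
  have h' : e ∈ Prod.fst '' {p : (ℕ → ℕ) × (ℕ → ℕ) | (p.1, p) ∈ U} ↔ ∃ y, (e, (e, y)) ∈ U := by
    simp
  rw [Set.mem_compl_iff, h'] at h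
  tauto

/-- The image of an analytic set under a Borel map is analytic. -/
lemma MeasureTheory.AnalyticSet.image_of_measurable {X Y : Type*} [TopologicalSpace X]
    [MeasurableSpace X] [BorelSpace X] [TopologicalSpace Y] [SecondCountableTopology Y]
    [MeasurableSpace Y] [OpensMeasurableSpace Y] {s : Set X} (hs : AnalyticSet s) {f : X → Y}
    (hf : Measurable f) : AnalyticSet (f '' s) := by
  rw [AnalyticSet] at hs
  rcases hs with rfl | ⟨g, hg, rfl⟩
  · simpa using analyticSet_empty
  · rw [← Set.range_comp, ← Set.image_univ]
    exact MeasurableSet.univ.analyticSet_image (hf.comp hg.measurable)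

/-- The space of sequences in a nontrivial type is uncountable. -/
lemma not_countable_sequences (α : Type*) [Nontrivial α] : ¬ Countable (ℕ → α) := by
  intro _
  obtain ⟨f, hf⟩ := exists_surjective_nat (ℕ → α)
  choose d hd using fun n => exists_ne (f n n)
  obtain ⟨n, hn⟩ := hf d
  exact hd n (congrFun hn n).symm

/-- For every Π¹₂ set P ⊆ 2^ω there is a coanalytic C ⊆ 2^ω × 2^ω such that
P = {α | C_α is Borel}. -/
theorem pi12_as_borel_sections (P : Set Cantor) (hP : Pi12 P) :
    ∃ C : Set (Cantor × Cantor), Coanalytic C ∧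
      P = {α : Cantor | MeasurableSet {β | (α, β) ∈ C}} := by
  obtain ⟨Q, hQ, hPQ⟩ := hP
  obtain ⟨A, hA, hAm⟩ := exists_analyticSet_not_measurableSet
  have hunc : ¬ Countable Cantor := not_countable_sequences _
  have hunc' : ¬ Countable ((ℕ → ℕ) × (ℕ → ℕ)) := fun _ =>
    not_countable_sequences ℕ (Prod.fst_surjective (β := ℕ → ℕ)).countable
  have hpol : PolishSpace (Fin 2) := inferInstance
  let φ : Cantor ≃ᵐ (ℕ → ℕ) × (ℕ → ℕ) := PolishSpace.measurableEquivOfNotCountable hunc hunc'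
  let g : Cantor × Cantor ≃ᵐ Cantor × ((ℕ → ℕ) × (ℕ → ℕ)) :=
    (MeasurableEquiv.refl _).prodCongr φ
  refine ⟨{p | (p.1, (φ p.2).1) ∈ Q ∧ (φ p.2).2 ∉ A}, ?_, ?_⟩
  · let T : Set (Cantor × ((ℕ → ℕ) × (ℕ → ℕ))) := {q | (q.1, q.2.1) ∈ Qᶜ} ∪ {q | q.2.2 ∈ A}
    have hT : AnalyticSet T := by
      rw [show T = ⋃ b : Bool, cond b {q | (q.1, q.2.1) ∈ Qᶜ} {q | q.2.2 ∈ A} from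
        Set.union_eq_iUnion]
      refine AnalyticSet.iUnion fun b => ?_
      cases b
      · exact hA.preimage (continuous_snd.comp continuous_snd)
      · exact AnalyticSet.preimage hQ
          (continuous_fst.prodMk (continuous_fst.comp continuous_snd))
    have := hT.image_of_measurable g.symm.measurable
    rw [MeasurableEquiv.image_symm] at this
    rw [Coanalytic]
    convert this using 1
    ext p
    simp only [Set.mem_compl_iff, Set.mem_ofPred_eq, not_and_or, not_not]
    rfl
  · ext α
    have hα : α ∉ P ↔ ∃ γ, (α, γ) ∈ Q := by
      rw [← Set.mem_compl_iff, hPQ]; simp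
    simp only [Set.mem_ofPred_eq]
    constructor
    · intro h
      have hne : ∀ γ, (α, γ) ∉ Q := by
        intro γ hγ
        exact hα.2 ⟨γ, hγ⟩ h
      simp [hne]
    · intro hm
      by_contra h
      obtain ⟨γ, hγ⟩ := hα.1 h
      have hψ : Measurable fun δ : ℕ → ℕ => φ.symm (γ, δ) :=
        φ.symm.measurable.comp measurable_prodMk_left
      have := hψ hm
      simp only [Set.preimage_ofPred_eq, MeasurableEquiv.apply_symm_apply, hγ, true_and] at this
      exact hAm this.of_compl
end
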